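/- For any normalized state ρ on registers S, L, E and any ε ∈ [0,1): H_min↑^{ε}(S|LE)_ρ ≥ H_min↑^{ε/3}(S|E)_ρ − I_max^{ε/3}(L:SE)_ρ. -/

import Mathlib

open scoped Kronecker
open Matrix
open scoped ComplexOrder

noncomputable section
namespace QITLeak

variable {A B : Type*}

/-- Real matrix power via spectral decomposition (Moore–Penrose pseudoinverse powers,
since `(0:ℝ) ^ (p:ℝ) = 0` for `p ≠ 0`). Junk value `0` on non-Hermitian input. -/
noncomputable def mpow [Fintype A] [DecidableEq A] (ρ : Matrix A A ℂ) (p : ℝ) :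
    Matrix A A ℂ :=
  if hρ : ρ.IsHermitian then
    (hρ.eigenvectorUnitary : Matrix A A ℂ) *
      Matrix.diagonal (fun i => ((hρ.eigenvalues i ^ p : ℝ) : ℂ)) *
      (star (hρ.eigenvectorUnitary : Matrix A A ℂ))
  else 0

/-- A normalized state (density matrix). -/
def IsState [Fintype A] (ρ : Matrix A A ℂ) : Prop := ρ.PosSemidef ∧ ρ.trace = 1

/-- A subnormalized state. -/
def IsSubState [Fintype A] (ρ : Matrix A A ℂ) : Prop := ρ.PosSemidef ∧ (ρ.trace).re ≤ 1

/-- Partial trace over the second tensor factor. -/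
def ptB [Fintype B] (ρ : Matrix (A × B) (A × B) ℂ) : Matrix A A ℂ :=
  Matrix.of fun a a' => ∑ b, ρ (a, b) (a', b)

/-- Partial trace over the first tensor factor. -/
def ptA [Fintype A] (ρ : Matrix (A × B) (A × B) ℂ) : Matrix B B ℂ :=
  Matrix.of fun b b' => ∑ a, ρ (a, b) (a, b')

/-- Partial trace over the factor `B`, along a decomposition `X ≃ A × B` of the registers. -/
def traceOut {X A B : Type*} [Fintype B] (e : X ≃ A × B) (ρ : Matrix X X ℂ) :
    Matrix A A ℂ :=
  Matrix.of fun a a' => ∑ b, ρ (e.symm (a, b)) (e.symm (a', b))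

/-- Support inclusion `supp ρ ⊆ supp σ` (for PSD matrices: kernel inclusion). -/
def suppSubset [Fintype A] (ρ σ : Matrix A A ℂ) : Prop :=
  ∀ v : A → ℂ, σ *ᵥ v = 0 → ρ *ᵥ v = 0

/-- The real-valued core formula of the sandwiched Rényi divergence (base 2). -/
def DR (α : ℝ) [Fintype A] [DecidableEq A] (ρ σ : Matrix A A ℂ) : ℝ :=
  (α - 1)⁻¹ * Real.logb 2
    (((mpow (mpow σ ((1 - α) / (2 * α)) * ρ * mpow σ ((1 - α) / (2 * α))) α).trace.re)
      / (ρ.trace).re)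

open scoped Classical in
/-- The sandwiched Rényi divergence `D_α(ρ‖σ)`, with value `⊤` outside the
support/orthogonality conditions. -/
def D (α : ℝ) [Fintype A] [DecidableEq A] (ρ σ : Matrix A A ℂ) : EReal :=
  if (α < 1 ∧ ¬ (ρ * σ = 0 ∧ σ * ρ = 0)) ∨ suppSubset ρ σ then ((DR α ρ σ : ℝ) : EReal)
  else ⊤

/-- The max-divergence `D_∞(ρ‖σ)`: log of the least `μ ≥ 0` with `ρ ≤ μσ` (`⊤` if none). -/
def Dmax [Fintype A] (ρ σ : Matrix A A ℂ) : EReal :=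
  sInf {x : EReal | ∃ μ : ℝ, 0 ≤ μ ∧ (μ • σ - ρ).PosSemidef ∧ x = ((Real.logb 2 μ : ℝ) : EReal)}

section Ent
variable [Fintype A] [DecidableEq A] [Fintype B] [DecidableEq B]

/-- `H_α↑(A|B)_ρ` for `ρ` on `A × B`. -/
def HUp (α : ℝ) (ρ : Matrix (A × B) (A × B) ℂ) : EReal :=
  - sInf {x : EReal | ∃ σ : Matrix B B ℂ, IsState σ ∧ x = D α ρ ((1 : Matrix A A ℂ) ⊗ₖ σ)}

/-- `H_α(A|B)_ρ` for `ρ` on `A × B`. -/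
def Hdn (α : ℝ) (ρ : Matrix (A × B) (A × B) ℂ) : EReal :=
  - D α ρ ((1 : Matrix A A ℂ) ⊗ₖ ptA ρ)

/-- `I_α↓(A;B)_ρ` for `ρ` on `A × B`. -/
def Idown (α : ℝ) (ρ : Matrix (A × B) (A × B) ℂ) : EReal :=
  sInf {x : EReal | ∃ σ : Matrix B B ℂ, IsState σ ∧ x = D α ρ ((ptB ρ) ⊗ₖ σ)}

/-- `I_α(A:B)_ρ` for `ρ` on `A × B`. -/
def Imut (α : ℝ) (ρ : Matrix (A × B) (A × B) ℂ) : EReal :=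
  D α ρ ((ptB ρ) ⊗ₖ (ptA ρ))

/-- `I_α↓↓(A:B)_ρ` for `ρ` on `A × B`. -/
def Idd (α : ℝ) (ρ : Matrix (A × B) (A × B) ℂ) : EReal :=
  sInf {x : EReal | ∃ (ω : Matrix A A ℂ) (σ : Matrix B B ℂ),
    IsState ω ∧ IsState σ ∧ x = D α ρ (ω ⊗ₖ σ)}

/-- `H_min↑(A|B)_ρ = H_∞↑(A|B)_ρ`. -/
def HminUp (ρ : Matrix (A × B) (A × B) ℂ) : EReal :=
  - sInf {x : EReal | ∃ σ : Matrix B B ℂ, IsState σ ∧ x = Dmax ρ ((1 : Matrix A A ℂ) ⊗ₖ σ)}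

/-- `I_∞↓(A;B)_ρ`. -/
def ImaxD (ρ : Matrix (A × B) (A × B) ℂ) : EReal :=
  sInf {x : EReal | ∃ σ : Matrix B B ℂ, IsState σ ∧ x = Dmax ρ ((ptB ρ) ⊗ₖ σ)}

/-- `I_∞(A:B)_ρ` (unoptimized max-information). -/
def ImaxND (ρ : Matrix (A × B) (A × B) ℂ) : EReal :=
  Dmax ρ ((ptB ρ) ⊗ₖ (ptA ρ))

/-- `I_∞↓↓(A:B)_ρ`. -/
def IddMax (ρ : Matrix (A × B) (A × B) ℂ) : EReal :=
  sInf {x : EReal | ∃ (ω : Matrix A A ℂ) (σ : Matrix B B ℂ),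
    IsState ω ∧ IsState σ ∧ x = Dmax ρ (ω ⊗ₖ σ)}

end Ent

/-- Trace norm. -/
def traceNorm [Fintype A] [DecidableEq A] (M : Matrix A A ℂ) : ℝ :=
  (mpow (Mᴴ * M) (1 / 2 : ℝ)).trace.re

/-- Generalized fidelity of subnormalized states. -/
def gFid [Fintype A] [DecidableEq A] (ρ σ : Matrix A A ℂ) : ℝ :=
  traceNorm (mpow ρ (1 / 2 : ℝ) * mpow σ (1 / 2 : ℝ)) +
    Real.sqrt ((1 - ρ.trace.re) * (1 - σ.trace.re))

/-- Purified distance. -/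
def pDist [Fintype A] [DecidableEq A] (ρ σ : Matrix A A ℂ) : ℝ :=
  Real.sqrt (1 - gFid ρ σ ^ 2)

section Smooth
variable [Fintype A] [DecidableEq A] [Fintype B] [DecidableEq B]

/-- Smoothed min-entropy `H_min↑,ε(A|B)_ρ`. -/
def HminUpEps (ε : ℝ) (ρ : Matrix (A × B) (A × B) ℂ) : EReal :=
  sSup {x : EReal | ∃ ρ' : Matrix (A × B) (A × B) ℂ,
    IsSubState ρ' ∧ pDist ρ' ρ ≤ ε ∧ x = HminUp ρ'}

/-- Smoothed max-information `I_max↓,ε(A;B)_ρ`. -/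
def ImaxDEps (ε : ℝ) (ρ : Matrix (A × B) (A × B) ℂ) : EReal :=
  sInf {x : EReal | ∃ ρ' : Matrix (A × B) (A × B) ℂ,
    IsSubState ρ' ∧ pDist ρ' ρ ≤ ε ∧ x = ImaxD ρ'}

/-- Smoothed (unoptimized) max-information `I_max^ε(A:B)_ρ`. -/
def ImaxNDEps (ε : ℝ) (ρ : Matrix (A × B) (A × B) ℂ) : EReal :=
  sInf {x : EReal | ∃ ρ' : Matrix (A × B) (A × B) ℂ,
    IsSubState ρ' ∧ pDist ρ' ρ ≤ ε ∧ x = ImaxND ρ'}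

/-- Smoothed max-information `I_max↓↓,ε(A:B)_ρ`. -/
def IddMaxEps (ε : ℝ) (ρ : Matrix (A × B) (A × B) ℂ) : EReal :=
  sInf {x : EReal | ∃ ρ' : Matrix (A × B) (A × B) ℂ,
    IsSubState ρ' ∧ pDist ρ' ρ ≤ ε ∧ x = IddMax ρ'}

/-- Smoothed Rényi conditional entropy `H_α↑,ε(A|B)_ρ`. -/
def HUpEps (α ε : ℝ) (ρ : Matrix (A × B) (A × B) ℂ) : EReal :=
  sSup {x : EReal | ∃ ρ' : Matrix (A × B) (A × B) ℂ,
    IsSubState ρ' ∧ pDist ρ' ρ ≤ ε ∧ x = HUp α ρ'}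

end Smooth

/-- Extension `id_R ⊗ Φ` of a linear map on matrices, with a spectator register on the left. -/
def lext {R A B : Type*} (Φ : Matrix A A ℂ →ₗ[ℂ] Matrix B B ℂ) :
    Matrix (R × A) (R × A) ℂ →ₗ[ℂ] Matrix (R × B) (R × B) ℂ where
  toFun ρ := Matrix.of fun p q => Φ (Matrix.of fun a a' => ρ (p.1, a) (q.1, a')) p.2 q.2
  map_add' x y := by
    ext p q
    show Φ ((Matrix.of fun a a' => x (p.1, a) (q.1, a'))
        + (Matrix.of fun a a' => y (p.1, a) (q.1, a'))) p.2 q.2 = _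
    rw [map_add]; rfl
  map_smul' c x := by
    ext p q
    show Φ (c • (Matrix.of fun a a' => x (p.1, a) (q.1, a'))) p.2 q.2 = _
    rw [_root_.map_smul]; rfl

/-- Extension `Φ ⊗ id_R` of a linear map on matrices, with a spectator register on the right. -/
def rext {A B R : Type*} (Φ : Matrix A A ℂ →ₗ[ℂ] Matrix B B ℂ) :
    Matrix (A × R) (A × R) ℂ →ₗ[ℂ] Matrix (B × R) (B × R) ℂ where
  toFun ρ := Matrix.of fun p q => Φ (Matrix.of fun a a' => ρ (a, p.2) (a', q.2)) p.1 q.1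
  map_add' x y := by
    ext p q
    show Φ ((Matrix.of fun a a' => x (a, p.2) (a', q.2))
        + (Matrix.of fun a a' => y (a, p.2) (a', q.2))) p.1 q.1 = _
    rw [map_add]; rfl
  map_smul' c x := by
    ext p q
    show Φ (c • (Matrix.of fun a a' => x (a, p.2) (a', q.2))) p.1 q.1 = _
    rw [_root_.map_smul]; rfl

/-- Completely positive trace-preserving map (quantum channel). -/
structure IsCPTP {A B : Type*} [Fintype A] [Fintype B]
    (Φ : Matrix A A ℂ →ₗ[ℂ] Matrix B B ℂ) : Prop where
  cp : ∀ (n : ℕ) (ρ : Matrix (Fin n × A) (Fin n × A) ℂ), ρ.PosSemidef →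
    ((lext Φ) ρ).PosSemidef
  tp : ∀ ρ : Matrix A A ℂ, (Φ ρ).trace = ρ.trace

/-- The rank-one (pure) state associated to a vector. -/
def pureState {A : Type*} (ψ : A → ℂ) : Matrix A A ℂ := Matrix.vecMulVec ψ (star ψ)


/-! ## Statement 3
Smoothed chain rule: `H_min↑^ε(S|LE)_ρ ≥ H_min↑^{ε/3}(S|E)_ρ − I_max^{ε/3}(L:SE)_ρ`. -/

/-- Register shuffle `S × (L × E) ≃ (S × E) × L`. -/
def eSEL (S L E : Type*) : S × (L × E) ≃ (S × E) × L where
  toFun x := ((x.1, x.2.2), x.2.1)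
  invFun y := (y.1.1, (y.2, y.1.2))
  left_inv _ := rfl
  right_inv _ := rfl

/-- Register shuffle `S × (L × E) ≃ L × (S × E)`. -/
def eLSE (S L E : Type*) : S × (L × E) ≃ L × (S × E) where
  toFun x := (x.2.1, (x.1, x.2.2))
  invFun y := (y.2.1, (y.1, y.2.2))
  left_inv _ := rfl
  right_inv _ := rfl

section MatrixPower
variable [Fintype A] [DecidableEq A] {M : Matrix A A ℂ}

lemma mpow_of_isHermitian (hM : M.IsHermitian) (p : ℝ) :
    mpow M p = (hM.eigenvectorUnitary : Matrix A A ℂ) *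
      Matrix.diagonal (fun i => ((hM.eigenvalues i ^ p : ℝ) : ℂ)) *
      (hM.eigenvectorUnitary : Matrix A A ℂ)ᴴ := by
  rw [mpow, dif_pos hM, star_eq_conjTranspose]

lemma mpow_posSemidef (hM : M.PosSemidef) (p : ℝ) : (mpow M p).PosSemidef := by
  rw [mpow_of_isHermitian hM.1]
  refine PosSemidef.mul_mul_conjTranspose_same (PosSemidef.diagonal fun i => ?_) _
  exact Complex.zero_le_real.2 (Real.rpow_nonneg (hM.eigenvalues_nonneg i) p)

lemma conjTranspose_mpow (hM : M.PosSemidef) (p : ℝ) : (mpow M p)ᴴ = mpow M p :=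
  (mpow_posSemidef hM p).1

lemma mpow_mul_mpow (hM : M.PosSemidef) {p q r : ℝ} (hr : p + q = r) (hr0 : r ≠ 0) :
    mpow M p * mpow M q = mpow M r := by
  have hU : (hM.1.eigenvectorUnitary : Matrix A A ℂ)ᴴ *
      (hM.1.eigenvectorUnitary : Matrix A A ℂ) = 1 := by
    rw [← star_eq_conjTranspose]; exact Unitary.coe_star_mul_self _
  subst hr
  simp only [mpow_of_isHermitian hM.1]
  have hD : (fun i => ((hM.1.eigenvalues i ^ (p + q) : ℝ) : ℂ)) =
      fun i => ((hM.1.eigenvalues i ^ p : ℝ) : ℂ) * ((hM.1.eigenvalues i ^ q : ℝ) : ℂ) := by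
    funext i
    rw [Real.rpow_add' (hM.eigenvalues_nonneg i) hr0]
    push_cast
    rfl
  rw [hD, ← diagonal_mul_diagonal]
  simp only [Matrix.mul_assoc]
  rw [← Matrix.mul_assoc (_)ᴴ, hU, Matrix.one_mul]

lemma mpow_comm (hM : M.PosSemidef) (p q : ℝ) : mpow M p * mpow M q = mpow M q * mpow M p := by
  have hU : (hM.1.eigenvectorUnitary : Matrix A A ℂ)ᴴ *
      (hM.1.eigenvectorUnitary : Matrix A A ℂ) = 1 := by
    rw [← star_eq_conjTranspose]; exact Unitary.coe_star_mul_self _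
  simp only [mpow_of_isHermitian hM.1, Matrix.mul_assoc]
  rw [← Matrix.mul_assoc (_)ᴴ, ← Matrix.mul_assoc (_)ᴴ, hU, Matrix.one_mul, Matrix.one_mul,
    ← Matrix.mul_assoc (diagonal _), ← Matrix.mul_assoc (diagonal _), diagonal_mul_diagonal,
    diagonal_mul_diagonal]
  simp only [mul_comm]

lemma mpow_one (hM : M.PosSemidef) : mpow M 1 = M := by
  conv_rhs => rw [hM.1.spectral_theorem, Unitary.conjStarAlgAut_apply]
  rw [mpow_of_isHermitian hM.1, ← star_eq_conjTranspose]
  simp only [Real.rpow_one]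
  rfl

lemma mpow_half_mul_self (hM : M.PosSemidef) : mpow M (1 / 2) * mpow M (1 / 2) = M := by
  rw [mpow_mul_mpow hM (r := 1) (by norm_num) one_ne_zero, mpow_one hM]

lemma mpow_neg_half_mul_self (hM : M.PosSemidef) : mpow M (-1 / 2) * M = mpow M (1 / 2) := by
  nth_rw 2 [← mpow_one hM]
  exact mpow_mul_mpow hM (by norm_num) (by norm_num)

/-- The orthogonal projection onto the support of a positive semidefinite matrix. -/
def suppProj (M : Matrix A A ℂ) : Matrix A A ℂ := mpow M (1 / 2) * mpow M (-1 / 2)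

lemma conjTranspose_suppProj (hM : M.PosSemidef) : (suppProj M)ᴴ = suppProj M := by
  rw [suppProj, conjTranspose_mul, conjTranspose_mpow hM, conjTranspose_mpow hM, mpow_comm hM]

lemma suppProj_mul (hM : M.PosSemidef) : suppProj M * M = M := by
  rw [suppProj, Matrix.mul_assoc, mpow_neg_half_mul_self hM, mpow_half_mul_self hM]

lemma mul_suppProj (hM : M.PosSemidef) : M * suppProj M = M := by
  have h := congrArg conjTranspose (suppProj_mul hM)
  rwa [conjTranspose_mul, conjTranspose_suppProj hM, hM.1.eq] at h

lemma mpow_neg_half_conj (hM : M.PosSemidef) :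
    mpow M (-1 / 2) * M * mpow M (-1 / 2) = suppProj M := by
  rw [mpow_neg_half_mul_self hM, suppProj]

lemma suppProj_mul_self (hM : M.PosSemidef) : suppProj M * suppProj M = suppProj M := by
  conv_lhs => enter [1]; rw [suppProj, mpow_comm hM]
  rw [suppProj, Matrix.mul_assoc, ← Matrix.mul_assoc (mpow M (1 / 2)), mpow_half_mul_self hM,
    ← Matrix.mul_assoc, mpow_neg_half_mul_self hM]

lemma one_sub_suppProj_posSemidef (hM : M.PosSemidef) : (1 - suppProj M).PosSemidef := by
  have h : (1 - suppProj M) = (1 - suppProj M) * (1 - suppProj M)ᴴ := by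
    rw [conjTranspose_sub, conjTranspose_one, conjTranspose_suppProj hM, Matrix.sub_mul,
      Matrix.mul_sub, Matrix.mul_sub, suppProj_mul_self hM]
    simp
  rw [h]
  exact posSemidef_self_mul_conjTranspose _

end MatrixPower

section Contraction
variable [Fintype A] [DecidableEq A] {C G : Type*} [Fintype C]

lemma contraction_conjTranspose [DecidableEq C] {V : Matrix A C ℂ} (hV : (1 - Vᴴ * V).PosSemidef) :
    (1 - V * Vᴴ).PosSemidef := by
  have h1 := posSemidef_self_mul_conjTranspose (1 - V * Vᴴ)
  have h2 := (hV.mul_mul_conjTranspose_same V).add h1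
  convert h2 using 1
  simp only [conjTranspose_sub, conjTranspose_one, conjTranspose_mul, conjTranspose_conjTranspose,
    Matrix.sub_mul, Matrix.mul_sub, Matrix.mul_one, Matrix.one_mul, Matrix.mul_assoc]
  abel

lemma contraction_mul [DecidableEq C] [Fintype G] {V : Matrix A C ℂ} {W : Matrix C G ℂ}
    (hV : (1 - V * Vᴴ).PosSemidef) (hW : (1 - W * Wᴴ).PosSemidef) :
    (1 - (V * W) * (V * W)ᴴ).PosSemidef := by
  convert (hW.mul_mul_conjTranspose_same V).add hV using 1
  simp only [conjTranspose_mul, Matrix.sub_mul, Matrix.mul_sub, Matrix.mul_one, Matrix.mul_assoc]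
  abel

/-- Douglas factorization: `X Xᴴ ≤ M` implies `X = √M V` for a contraction `V`. -/
lemma exists_eq_mpow_half_mul {M : Matrix A A ℂ} (hM : M.PosSemidef) {X : Matrix A C ℂ}
    (hX : (M - X * Xᴴ).PosSemidef) :
    ∃ V : Matrix A C ℂ, X = mpow M (1 / 2) * V ∧ (1 - V * Vᴴ).PosSemidef := by
  refine ⟨mpow M (-1 / 2) * X, ?_, ?_⟩
  · have h0 : (1 - suppProj M) * X = 0 := by
      rw [← self_mul_conjTranspose_eq_zero]
      have h := hX.mul_mul_conjTranspose_same (1 - suppProj M)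
      have hz : (1 - suppProj M) * M = 0 := by
        rw [Matrix.sub_mul, suppProj_mul hM, Matrix.one_mul, sub_self]
      rw [Matrix.mul_sub, hz, zero_sub] at h
      have h' := posSemidef_self_mul_conjTranspose ((1 - suppProj M) * X)
      rw [← h'.trace_eq_zero_iff]
      refine le_antisymm ?_ h'.trace_nonneg
      have := h.trace_nonneg
      rw [Matrix.neg_mul, trace_neg, neg_nonneg] at this
      simpa only [conjTranspose_mul, Matrix.mul_assoc] using this
    rw [← Matrix.mul_assoc]
    rw [Matrix.sub_mul, Matrix.one_mul, sub_eq_zero] at h0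
    exact h0
  · convert (one_sub_suppProj_posSemidef hM).add
      (hX.mul_mul_conjTranspose_same (mpow M (-1 / 2))) using 1
    rw [← mpow_neg_half_conj hM, conjTranspose_mul, conjTranspose_mpow hM, Matrix.mul_sub,
      Matrix.sub_mul]
    simp only [Matrix.mul_assoc]
    abel

end Contraction

section TraceNorm
variable [Fintype A] [DecidableEq A]

/-- Polar decomposition. -/
lemma exists_polar (M : Matrix A A ℂ) :
    ∃ V : Matrix A A ℂ, (1 - V * Vᴴ).PosSemidef ∧ M = V * mpow (Mᴴ * M) (1 / 2) ∧
      Vᴴ * M = mpow (Mᴴ * M) (1 / 2) := by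
  have hP := posSemidef_conjTranspose_mul_self M
  refine ⟨M * mpow (Mᴴ * M) (-1 / 2), contraction_conjTranspose ?_, ?_, ?_⟩
  · rw [conjTranspose_mul, conjTranspose_mpow hP]
    have := one_sub_suppProj_posSemidef hP
    rw [← mpow_neg_half_conj hP] at this
    simpa only [Matrix.mul_assoc] using this
  · rw [Matrix.mul_assoc, mpow_comm hP]
    change M = M * suppProj (Mᴴ * M)
    have h : M - M * suppProj (Mᴴ * M) = 0 := by
      have hfac : M - M * suppProj (Mᴴ * M) = M * (1 - suppProj (Mᴴ * M)) := by
        rw [Matrix.mul_sub, Matrix.mul_one]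
      rw [← conjTranspose_mul_self_eq_zero, hfac, conjTranspose_mul, Matrix.mul_assoc,
        ← Matrix.mul_assoc Mᴴ, Matrix.mul_sub (Mᴴ * M), mul_suppProj hP, Matrix.mul_one,
        sub_self, Matrix.mul_zero]
    exact sub_eq_zero.1 h
  · rw [conjTranspose_mul, conjTranspose_mpow hP, Matrix.mul_assoc, mpow_neg_half_mul_self hP]

lemma traceNorm_nonneg (M : Matrix A A ℂ) : 0 ≤ traceNorm M :=
  (Complex.le_def.1 (mpow_posSemidef (posSemidef_conjTranspose_mul_self M) _).trace_nonneg).1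

lemma exists_trace_mul_eq_traceNorm (M : Matrix A A ℂ) :
    ∃ W : Matrix A A ℂ, (1 - W * Wᴴ).PosSemidef ∧ (W * M).trace.re = traceNorm M := by
  obtain ⟨V, hV, -, h⟩ := exists_polar M
  refine ⟨Vᴴ, contraction_conjTranspose (by simpa using hV), by rw [h, traceNorm]⟩

lemma re_trace_mul_le_traceNorm (M : Matrix A A ℂ) {W : Matrix A A ℂ}
    (hW : (1 - W * Wᴴ).PosSemidef) : (W * M).trace.re ≤ traceNorm M := by
  obtain ⟨V, hV, hM, -⟩ := exists_polar M
  have hP := posSemidef_conjTranspose_mul_self M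
  have hK := contraction_conjTranspose (V := (W * V)ᴴ)
    (by simpa only [conjTranspose_conjTranspose] using contraction_mul hW hV)
  rw [conjTranspose_conjTranspose] at hK
  rw [traceNorm]
  have hWM : W * M = W * V * mpow (Mᴴ * M) (1 / 2) := by
    conv_lhs => rw [hM]
    rw [Matrix.mul_assoc]
  rw [hWM]
  have hPpos := mpow_posSemidef hP (1 / 2)
  generalize mpow (Mᴴ * M) (1 / 2) = P at hPpos
  generalize W * V = K at hK
  have hQ := conjTranspose_mpow hPpos (1 / 2)
  have hQQ := mpow_half_mul_self hPpos
  generalize mpow P (1 / 2) = Q at hQ hQQ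
  have h := (((posSemidef_conjTranspose_mul_self (1 - K)).add hK).mul_mul_conjTranspose_same
    Q).trace_nonneg
  have hsum : (1 - K)ᴴ * (1 - K) + (1 - Kᴴ * K) = (1 - K) + (1 - Kᴴ) := by
    simp only [conjTranspose_sub, conjTranspose_one, Matrix.sub_mul, Matrix.mul_sub,
      Matrix.mul_one, Matrix.one_mul]
    abel
  have hconj : (Kᴴ * P).trace.re = (K * P).trace.re := by
    have : Kᴴ * P = (P * K)ᴴ := by rw [conjTranspose_mul, hPpos.1.eq]
    rw [this, trace_conjTranspose, trace_mul_comm]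
    exact Complex.conj_re _
  rw [hsum, hQ, trace_mul_comm, ← Matrix.mul_assoc, hQQ, trace_mul_comm] at h
  have h' := (Complex.le_def.1 h).1
  simp only [Matrix.add_mul, Matrix.sub_mul, Matrix.one_mul, trace_add, trace_sub, Complex.add_re,
    Complex.sub_re, hconj, Complex.zero_re] at h'
  linarith

end TraceNorm

section Fidelity
variable [Fintype A]

lemma re_trace_conjTranspose_mul_comm {C : Type*} [Fintype C] (X Y : Matrix A C ℂ) :
    (Xᴴ * Y).trace.re = (Yᴴ * X).trace.re := by
  have : Yᴴ * X = (Xᴴ * Y)ᴴ := by rw [conjTranspose_mul, conjTranspose_conjTranspose]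
  rw [this, trace_conjTranspose]
  exact (Complex.conj_re _).symm

/-- A matrix together with a real number, as a vector of a Hilbert space. -/
def extVec (X : Matrix A A ℂ) (s : ℝ) : EuclideanSpace ℂ (Option (A × A)) :=
  WithLp.toLp 2 fun o => o.elim (s : ℂ) fun p => X p.1 p.2

lemma re_inner_extVec (X Y : Matrix A A ℂ) (s t : ℝ) :
    (inner ℂ (extVec X s) (extVec Y t)).re = (Xᴴ * Y).trace.re + s * t := by
  simp only [PiLp.inner_apply, extVec, Fintype.sum_option, Option.elim, RCLike.inner_apply,
    Complex.add_re, Matrix.trace, Matrix.diag, Matrix.mul_apply, conjTranspose_apply,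
    Fintype.sum_prod_type]
  rw [Finset.sum_comm, add_comm]
  congr 1
  · simp only [mul_comm]; rfl
  · simp [mul_comm]

lemma norm_extVec_sq (X : Matrix A A ℂ) (s : ℝ) :
    ‖extVec X s‖ ^ 2 = (X * Xᴴ).trace.re + s ^ 2 := by
  have h := inner_self_eq_norm_sq (𝕜 := ℂ) (extVec X s)
  rw [← h]
  change (inner ℂ (extVec X s) (extVec X s)).re = _
  rw [re_inner_extVec, trace_mul_comm, sq]

variable {ρ σ : Matrix A A ℂ}

lemma norm_extVec_le_one {X : Matrix A A ℂ} (hρ : IsSubState ρ) (hX : (ρ - X * Xᴴ).PosSemidef) :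
    ‖extVec X √(1 - ρ.trace.re)‖ ≤ 1 := by
  have h := (Complex.le_def.1 hX.trace_nonneg).1
  rw [trace_sub, Complex.sub_re, Complex.zero_re] at h
  rw [← sq_le_one_iff₀ (norm_nonneg _), norm_extVec_sq, Real.sq_sqrt (by linarith [hρ.2])]
  linarith

variable [DecidableEq A]

/-- The root fidelity `‖√ρ √σ‖₁`. -/
def rootFid (ρ σ : Matrix A A ℂ) : ℝ := traceNorm (mpow ρ (1 / 2 : ℝ) * mpow σ (1 / 2 : ℝ))

lemma re_trace_le_rootFid {C : Type*} [Fintype C] (hρ : ρ.PosSemidef) (hσ : σ.PosSemidef)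
    {X Y : Matrix A C ℂ} (hX : (ρ - X * Xᴴ).PosSemidef) (hY : (σ - Y * Yᴴ).PosSemidef) :
    (Xᴴ * Y).trace.re ≤ rootFid ρ σ := by
  classical
  obtain ⟨V, rfl, hV⟩ := exists_eq_mpow_half_mul hρ hX
  obtain ⟨U, rfl, hU⟩ := exists_eq_mpow_half_mul hσ hY
  have hV' : (1 - Vᴴ * Vᴴᴴ).PosSemidef :=
    contraction_conjTranspose (by rwa [conjTranspose_conjTranspose])
  refine le_trans (le_of_eq ?_) (re_trace_mul_le_traceNorm _ (contraction_mul hU hV'))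
  rw [conjTranspose_mul, conjTranspose_mpow hρ, Matrix.mul_assoc U, trace_mul_comm U]
  simp only [Matrix.mul_assoc]

lemma exists_re_trace_eq_rootFid (hρ : ρ.PosSemidef) (σ : Matrix A A ℂ) :
    ∃ X : Matrix A A ℂ, (ρ - X * Xᴴ).PosSemidef ∧
      (Xᴴ * mpow σ (1 / 2)).trace.re = rootFid ρ σ := by
  obtain ⟨W, hW, h⟩ := exists_trace_mul_eq_traceNorm (mpow ρ (1 / 2) * mpow σ (1 / 2))
  refine ⟨mpow ρ (1 / 2) * Wᴴ, ?_, ?_⟩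
  · have hW' : (1 - Wᴴ * Wᴴᴴ).PosSemidef :=
      contraction_conjTranspose (by rwa [conjTranspose_conjTranspose])
    have := hW'.mul_mul_conjTranspose_same (mpow ρ (1 / 2))
    rw [Matrix.mul_sub, Matrix.sub_mul, Matrix.mul_one, conjTranspose_mpow hρ,
      mpow_half_mul_self hρ] at this
    simpa only [conjTranspose_mul, conjTranspose_mpow hρ, Matrix.mul_assoc] using this
  · rw [rootFid, ← h, conjTranspose_mul, conjTranspose_mpow hρ, conjTranspose_conjTranspose,
      Matrix.mul_assoc]

lemma mpow_half_mul_conjTranspose (hρ : ρ.PosSemidef) :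
    mpow ρ (1 / 2) * (mpow ρ (1 / 2))ᴴ = ρ := by
  rw [conjTranspose_mpow hρ, mpow_half_mul_self hρ]

lemma sub_mpow_half_posSemidef (hρ : ρ.PosSemidef) :
    (ρ - mpow ρ (1 / 2) * (mpow ρ (1 / 2))ᴴ).PosSemidef := by
  rw [mpow_half_mul_conjTranspose hρ, sub_self]
  exact PosSemidef.zero

lemma rootFid_comm_le (hρ : ρ.PosSemidef) (hσ : σ.PosSemidef) : rootFid ρ σ ≤ rootFid σ ρ := by
  obtain ⟨X, hX, h⟩ := exists_re_trace_eq_rootFid hρ σ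
  rw [← h, re_trace_conjTranspose_mul_comm]
  exact re_trace_le_rootFid hσ hρ (sub_mpow_half_posSemidef hσ) hX

lemma rootFid_comm (hρ : ρ.PosSemidef) (hσ : σ.PosSemidef) : rootFid ρ σ = rootFid σ ρ :=
  (rootFid_comm_le hρ hσ).antisymm (rootFid_comm_le hσ hρ)

lemma rootFid_nonneg (ρ σ : Matrix A A ℂ) : 0 ≤ rootFid ρ σ := traceNorm_nonneg _

lemma gFid_nonneg (ρ σ : Matrix A A ℂ) : 0 ≤ gFid ρ σ :=
  add_nonneg (rootFid_nonneg ρ σ) (Real.sqrt_nonneg _)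

lemma gFid_comm (hρ : ρ.PosSemidef) (hσ : σ.PosSemidef) : gFid ρ σ = gFid σ ρ := by
  change rootFid ρ σ + _ = rootFid σ ρ + _
  rw [rootFid_comm hρ hσ, mul_comm (1 - ρ.trace.re)]

lemma pDist_comm (hρ : ρ.PosSemidef) (hσ : σ.PosSemidef) : pDist ρ σ = pDist σ ρ := by
  rw [pDist, pDist, gFid_comm hρ hσ]

lemma pDist_le_of_gFid_le {B : Type*} [Fintype B] [DecidableEq B] {ρ' σ' : Matrix B B ℂ}
    (h : gFid ρ σ ≤ gFid ρ' σ') : pDist ρ' σ' ≤ pDist ρ σ :=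
  Real.sqrt_le_sqrt (sub_le_sub_left (pow_le_pow_left₀ (gFid_nonneg _ _) h 2) 1)

lemma norm_extVec_mpow_half (hρ : IsSubState ρ) :
    ‖extVec (mpow ρ (1 / 2)) √(1 - ρ.trace.re)‖ = 1 := by
  rw [← pow_eq_one_iff_of_nonneg (norm_nonneg _) two_ne_zero, norm_extVec_sq,
    Real.sq_sqrt (by linarith [hρ.2]), mpow_half_mul_conjTranspose hρ.1]
  ring

lemma exists_extVec_inner_eq_gFid (hρ : IsSubState ρ) (σ : Matrix A A ℂ) :
    ∃ X : Matrix A A ℂ, (ρ - X * Xᴴ).PosSemidef ∧ ‖extVec X √(1 - ρ.trace.re)‖ ≤ 1 ∧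
      (inner ℂ (extVec X √(1 - ρ.trace.re))
        (extVec (mpow σ (1 / 2)) √(1 - σ.trace.re))).re = gFid ρ σ := by
  obtain ⟨X, hX, h⟩ := exists_re_trace_eq_rootFid hρ.1 σ
  refine ⟨X, hX, norm_extVec_le_one hρ hX, ?_⟩
  rw [re_inner_extVec, h, ← Real.sqrt_mul (by linarith [hρ.2])]
  rfl

lemma gFid_le_one (hρ : IsSubState ρ) (hσ : IsSubState σ) : gFid ρ σ ≤ 1 := by
  obtain ⟨X, -, hX, h⟩ := exists_extVec_inner_eq_gFid hρ σ
  rw [← h]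
  refine (re_inner_le_norm (𝕜 := ℂ) _ _).trans ?_
  rw [norm_extVec_mpow_half hσ, mul_one]
  exact hX

lemma re_inner_ge_of_norm_le_one {H : Type*} [NormedAddCommGroup H] [InnerProductSpace ℂ H]
    {x y z : H} (hx : ‖x‖ ≤ 1) (hy : ‖y‖ = 1) (hz : ‖z‖ ≤ 1) {a b : ℝ}
    (ha : (inner ℂ x y).re = a) (hb : (inner ℂ z y).re = b) :
    a * b - √(1 - a ^ 2) * √(1 - b ^ 2) ≤ (inner ℂ x z).re := by
  have key : ∀ {w : H} {c : ℝ}, ‖w‖ ≤ 1 → (inner ℂ w y).re = c →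
      ‖w - (c : ℂ) • y‖ ≤ √(1 - c ^ 2) := by
    intro w c hw hc
    apply Real.le_sqrt_of_sq_le
    have h := norm_sub_sq (𝕜 := ℂ) w ((c : ℂ) • y)
    rw [inner_smul_right, norm_smul, hy] at h
    have h2 : RCLike.re ((c : ℂ) * inner ℂ w y) = c * c := by
      rw [← hc]; exact Complex.re_ofReal_mul _ _
    rw [h2, Complex.norm_real, Real.norm_eq_abs, mul_one, sq_abs] at h
    have : ‖w‖ ^ 2 ≤ 1 := pow_le_one₀ (norm_nonneg _) hw
    linarith
  have h1 := (Complex.abs_re_le_norm (inner ℂ (x - (a : ℂ) • y) (z - (b : ℂ) • y))).trans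
    (norm_inner_le_norm _ _)
  have h2 : ‖x - (a : ℂ) • y‖ * ‖z - (b : ℂ) • y‖ ≤ √(1 - a ^ 2) * √(1 - b ^ 2) :=
    mul_le_mul (key hx ha) (key hz hb) (norm_nonneg _) (Real.sqrt_nonneg _)
  have h3 := (abs_le.1 (h1.trans h2)).1
  have hb' : (inner ℂ y z).re = b := by rw [← hb, ← inner_conj_symm, Complex.conj_re]
  have hyy : inner ℂ y y = (1 : ℂ) := by simp [inner_self_eq_norm_sq_to_K, hy]
  have h4 : (inner ℂ (x - (a : ℂ) • y) (z - (b : ℂ) • y)).re = (inner ℂ x z).re - a * b := by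
    simp only [inner_sub_left, inner_sub_right, inner_smul_left, inner_smul_right, hyy,
      Complex.conj_ofReal, Complex.sub_re, Complex.re_ofReal_mul, ha, hb', mul_one,
      Complex.ofReal_re]
    ring
  rw [h4] at h3
  linarith

lemma sqrt_one_sub_sq_le_add {a b c : ℝ} (ha : 0 ≤ a) (ha1 : a ≤ 1) (hb : 0 ≤ b) (hb1 : b ≤ 1)
    (h : a * b - √(1 - a ^ 2) * √(1 - b ^ 2) ≤ c) :
    √(1 - c ^ 2) ≤ √(1 - a ^ 2) + √(1 - b ^ 2) := by
  have hs := Real.sq_sqrt (show 0 ≤ 1 - a ^ 2 by nlinarith)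
  have ht := Real.sq_sqrt (show 0 ≤ 1 - b ^ 2 by nlinarith)
  have hs0 := Real.sqrt_nonneg (1 - a ^ 2)
  have ht0 := Real.sqrt_nonneg (1 - b ^ 2)
  generalize √(1 - a ^ 2) = s at *
  generalize √(1 - b ^ 2) = t at *
  rw [Real.sqrt_le_left (by positivity)]
  rcases le_total 0 (a * b - s * t) with hd | hd
  · have h1 : (a * b - s * t) ^ 2 ≤ c ^ 2 := pow_le_pow_left₀ hd h 2
    have h2 : (a * b - s * t) ^ 2 + (a * t + b * s) ^ 2 = 1 := by
      linear_combination (b ^ 2 + t ^ 2) * hs + ht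
    have h3 : a * t + b * s ≤ s + t := by nlinarith
    have h4 : (a * t + b * s) ^ 2 ≤ (s + t) ^ 2 := pow_le_pow_left₀ (by positivity) h3 2
    linarith
  · have h1 : (a * b) ^ 2 ≤ (s * t) ^ 2 := pow_le_pow_left₀ (by positivity) (by linarith) 2
    have h2 : 1 ≤ s ^ 2 + t ^ 2 := by
      rw [mul_pow, mul_pow, hs, ht] at h1
      rw [hs, ht]; linarith
    nlinarith [mul_nonneg hs0 ht0, sq_nonneg c]

lemma pDist_triangle {τ : Matrix A A ℂ} (hρ : IsSubState ρ) (hσ : IsSubState σ)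
    (hτ : IsSubState τ) : pDist ρ τ ≤ pDist ρ σ + pDist σ τ := by
  obtain ⟨X, hX, hX1, h1⟩ := exists_extVec_inner_eq_gFid hρ σ
  obtain ⟨Y, hY, hY1, h2⟩ := exists_extVec_inner_eq_gFid hτ σ
  have h := re_inner_ge_of_norm_le_one hX1 (norm_extVec_mpow_half hσ) hY1 h1 h2
  rw [pDist_comm hσ.1 hτ.1]
  refine sqrt_one_sub_sq_le_add (gFid_nonneg _ _) (gFid_le_one hρ hσ) (gFid_nonneg _ _)
    (gFid_le_one hτ hσ) (h.trans ?_)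
  rw [re_inner_extVec, ← Real.sqrt_mul (by linarith [hρ.2])]
  exact add_le_add_left (re_trace_le_rootFid hρ.1 hτ.1 hX hY) _

end Fidelity

section PartialTrace
variable {L K : Type*} [Fintype L]

lemma ptA_eq_sum (N : Matrix (L × K) (L × K) ℂ) :
    ptA N = ∑ l, N.submatrix (fun k => (l, k)) (fun k => (l, k)) := by
  ext k k'
  simp [ptA, Matrix.sum_apply]

lemma ptA_posSemidef {N : Matrix (L × K) (L × K) ℂ} (hN : N.PosSemidef) : (ptA N).PosSemidef := by
  rw [ptA_eq_sum]
  exact posSemidef_sum _ fun l _ => hN.submatrix _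

lemma ptB_posSemidef {N : Matrix (K × L) (K × L) ℂ} (hN : N.PosSemidef) : (ptB N).PosSemidef := by
  have : ptB N = ∑ l, N.submatrix (fun k => (k, l)) (fun k => (k, l)) := by
    ext k k'
    simp [ptB, Matrix.sum_apply]
  rw [this]
  exact posSemidef_sum _ fun l _ => hN.submatrix _

lemma ptA_sub (M N : Matrix (L × K) (L × K) ℂ) : ptA (M - N) = ptA M - ptA N := by
  ext k k'
  simp [ptA, Finset.sum_sub_distrib]

/-- Move the first row register of a matrix to the columns. -/
def moveRow {C : Type*} (X : Matrix (L × K) C ℂ) : Matrix K (L × C) ℂ :=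
  Matrix.of fun k p => X (p.1, k) p.2

lemma moveRow_mul_conjTranspose {C : Type*} [Fintype C] (X Y : Matrix (L × K) C ℂ) :
    moveRow X * (moveRow Y)ᴴ = ptA (X * Yᴴ) := by
  ext k k'
  simp [moveRow, ptA, Matrix.mul_apply, Fintype.sum_prod_type]

variable [Fintype K]

lemma trace_ptA (N : Matrix (L × K) (L × K) ℂ) : (ptA N).trace = N.trace := by
  simp only [ptA, Matrix.trace, Matrix.diag, of_apply, Fintype.sum_prod_type]
  exact Finset.sum_comm

lemma trace_ptB (N : Matrix (L × K) (L × K) ℂ) : (ptB N).trace = N.trace := by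
  simp only [ptB, Matrix.trace, Matrix.diag, of_apply, Fintype.sum_prod_type]

lemma IsSubState.ptA {N : Matrix (L × K) (L × K) ℂ} (hN : IsSubState N) :
    IsSubState (ptA N) :=
  ⟨ptA_posSemidef hN.1, by rw [trace_ptA]; exact hN.2⟩

lemma trace_conjTranspose_moveRow_mul {C : Type*} [Fintype C] (X Y : Matrix (L × K) C ℂ) :
    ((moveRow X)ᴴ * moveRow Y).trace = (Xᴴ * Y).trace := by
  rw [trace_mul_comm, moveRow_mul_conjTranspose, trace_ptA, trace_mul_comm]

variable [DecidableEq L]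

lemma trace_one_kronecker_mul (T : Matrix K K ℂ) (τ : Matrix (L × K) (L × K) ℂ) :
    (((1 : Matrix L L ℂ) ⊗ₖ T) * τ).trace = (T * ptA τ).trace := by
  simp only [Matrix.trace, Matrix.diag, Matrix.mul_apply, kroneckerMap_apply, Matrix.one_apply,
    Fintype.sum_prod_type, ptA, of_apply, ite_mul, one_mul, zero_mul, Finset.sum_ite_irrel,
    Finset.sum_const_zero, Finset.sum_ite_eq, Finset.mem_univ, if_true, Finset.mul_sum]
  rw [Finset.sum_comm]
  exact Finset.sum_congr rfl fun k _ => Finset.sum_comm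

variable [DecidableEq K]

lemma rootFid_le_rootFid_ptA {ρ σ : Matrix (L × K) (L × K) ℂ} (hρ : ρ.PosSemidef)
    (hσ : σ.PosSemidef) : rootFid ρ σ ≤ rootFid (ptA ρ) (ptA σ) := by
  obtain ⟨X, hX, h⟩ := exists_re_trace_eq_rootFid hρ σ
  rw [← h, ← trace_conjTranspose_moveRow_mul]
  refine re_trace_le_rootFid (ptA_posSemidef hρ) (ptA_posSemidef hσ) ?_ ?_
  · rw [moveRow_mul_conjTranspose, ← ptA_sub]
    exact ptA_posSemidef hX
  · rw [moveRow_mul_conjTranspose, ← ptA_sub]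
    exact ptA_posSemidef (sub_mpow_half_posSemidef hσ)

lemma pDist_ptA_le {ρ σ : Matrix (L × K) (L × K) ℂ} (hρ : ρ.PosSemidef) (hσ : σ.PosSemidef) :
    pDist (ptA ρ) (ptA σ) ≤ pDist ρ σ := by
  apply pDist_le_of_gFid_le
  rw [gFid, gFid, trace_ptA, trace_ptA]
  exact add_le_add_left (rootFid_le_rootFid_ptA hρ hσ) _

/-- Any substate `ω` of a marginal register extends to a substate at least as close to `τ` as `ω`
is to the marginal of `τ`, such that bounds of `τ` against a product with its marginal carry over
to bounds against the product with `ω`. -/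
lemma exists_extension {τ : Matrix (L × K) (L × K) ℂ} (hτ : IsSubState τ) {ω : Matrix K K ℂ}
    (hω : IsSubState ω) :
    ∃ η : Matrix (L × K) (L × K) ℂ, IsSubState η ∧ pDist η τ ≤ pDist ω (ptA τ) ∧
      ∀ (μ : ℝ), 0 ≤ μ → ∀ θ : Matrix L L ℂ, θ.PosSemidef →
        (μ • (θ ⊗ₖ ptA τ) - τ).PosSemidef → (μ • (θ ⊗ₖ ω) - η).PosSemidef := by
  have hκ := hτ.ptA
  obtain ⟨W, hW, hWtr⟩ :=
    exists_trace_mul_eq_traceNorm (mpow (ptA τ) (1 / 2) * mpow ω (1 / 2))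
  set T : Matrix K K ℂ := mpow ω (1 / 2) * (W * mpow (ptA τ) (-1 / 2)) with hT
  have hTκ : (ω - T * ptA τ * Tᴴ).PosSemidef := by
    have h1 := (one_sub_suppProj_posSemidef hκ.1).mul_mul_conjTranspose_same W
    have h2 := (h1.add hW).mul_mul_conjTranspose_same (mpow ω (1 / 2))
    convert h2 using 1
    rw [← mpow_neg_half_conj hκ.1, hT]
    simp only [conjTranspose_mul, conjTranspose_mpow hκ.1, conjTranspose_mpow hω.1,
      Matrix.mul_sub, Matrix.sub_mul, Matrix.mul_one, Matrix.mul_add, Matrix.add_mul,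
      Matrix.mul_assoc]
    rw [mpow_half_mul_self hω.1]
    abel
  have hfid : (T * ptA τ).trace.re = rootFid ω (ptA τ) := by
    rw [rootFid_comm hω.1 hκ.1, rootFid, ← hWtr, hT, Matrix.mul_assoc, Matrix.mul_assoc,
      mpow_neg_half_mul_self hκ.1, trace_mul_comm, Matrix.mul_assoc]
  set T' : Matrix (L × K) (L × K) ℂ := (1 : Matrix L L ℂ) ⊗ₖ T with hT'
  have hconj : ∀ (θ : Matrix L L ℂ), T' * (θ ⊗ₖ ptA τ) * T'ᴴ = θ ⊗ₖ (T * ptA τ * Tᴴ) := by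
    intro θ
    rw [hT', conjTranspose_kronecker, ← mul_kronecker_mul, ← mul_kronecker_mul,
      conjTranspose_one, Matrix.one_mul, Matrix.mul_one]
  have hη := hτ.1.mul_mul_conjTranspose_same T'
  have htr : (T' * τ * T'ᴴ).trace.re ≤ ω.trace.re := by
    have h1 : (T' * τ * T'ᴴ).trace = (T * ptA τ * Tᴴ).trace := by
      rw [trace_mul_comm, ← Matrix.mul_assoc, trace_mul_comm (T * _), ← Matrix.mul_assoc, hT',
        conjTranspose_kronecker, conjTranspose_one, ← mul_kronecker_mul, Matrix.one_mul,
        trace_one_kronecker_mul]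
    have h2 := (Complex.le_def.1 hTκ.trace_nonneg).1
    rw [trace_sub, Complex.sub_re, Complex.zero_re] at h2
    rw [h1]
    linarith
  refine ⟨T' * τ * T'ᴴ, ⟨hη, htr.trans hω.2⟩, ?_, ?_⟩
  · apply pDist_le_of_gFid_le
    refine add_le_add ?_ (Real.sqrt_le_sqrt ?_)
    · change rootFid ω (ptA τ) ≤ rootFid _ τ
      rw [← hfid, ← trace_one_kronecker_mul, ← hT', rootFid_comm hη hτ.1]
      refine le_trans (le_of_eq ?_) (re_trace_le_rootFid hτ.1 hη (X := mpow τ (1 / 2))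
        (Y := T' * mpow τ (1 / 2)) (sub_mpow_half_posSemidef hτ.1) ?_)
      · rw [conjTranspose_mpow hτ.1, trace_mul_comm (mpow τ _), Matrix.mul_assoc,
          mpow_half_mul_self hτ.1]
      · have := (sub_mpow_half_posSemidef hτ.1).mul_mul_conjTranspose_same T'
        simpa only [conjTranspose_mul, Matrix.mul_sub, Matrix.sub_mul, Matrix.mul_assoc] using this
    · rw [trace_ptA]
      exact mul_le_mul_of_nonneg_right (by linarith) (by linarith [hτ.2])
  · intro μ hμ θ hθ h
    have h1 := h.mul_mul_conjTranspose_same T'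
    rw [Matrix.mul_sub, Matrix.sub_mul, Matrix.mul_smul, Matrix.smul_mul, hconj] at h1
    have h2 := (hθ.kronecker hTκ).smul hμ
    convert h1.add h2 using 1
    have h3 : θ ⊗ₖ (ω - T * ptA τ * Tᴴ) = θ ⊗ₖ ω - θ ⊗ₖ (T * ptA τ * Tᴴ) := by
      ext; simp [mul_sub]
    rw [h3, smul_sub]
    abel

end PartialTrace

section States
variable [Fintype A]

lemma trace_submatrix_equiv {B : Type*} [Fintype B] (e : B ≃ A) (M : Matrix A A ℂ) :
    (M.submatrix e e).trace = M.trace :=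
  Equiv.sum_comp e fun a => M a a

lemma IsState.isSubState {ρ : Matrix A A ℂ} (hρ : IsState ρ) : IsSubState ρ :=
  ⟨hρ.1, by rw [hρ.2, Complex.one_re]⟩

lemma pos_of_smul_sub_posSemidef {M N : Matrix A A ℂ} (hN : N.PosSemidef) (hN0 : N ≠ 0) {μ : ℝ}
    (hμ : 0 ≤ μ) (h : (μ • M - N).PosSemidef) : 0 < μ := by
  refine hμ.lt_of_ne fun h0 => hN0 ?_
  subst h0
  rw [zero_smul, zero_sub] at h
  refine hN.trace_eq_zero_iff.1 (le_antisymm ?_ hN.trace_nonneg)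
  have := h.trace_nonneg
  rwa [trace_neg, neg_nonneg] at this

lemma exists_state_ge {θ : Matrix A A ℂ} (hθ : θ.PosSemidef) (hθ1 : θ.trace.re ≤ 1)
    (hθ0 : θ.trace ≠ 0) : ∃ ξ : Matrix A A ℂ, IsState ξ ∧ (ξ - θ).PosSemidef := by
  have hnn := Complex.le_def.1 hθ.trace_nonneg
  have htr : θ.trace = (θ.trace.re : ℂ) := Complex.ext rfl (by simpa using hnn.2.symm)
  have hpos : 0 < θ.trace.re :=
    lt_of_le_of_ne hnn.1 fun h => hθ0 (by rw [htr, ← h]; simp)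
  refine ⟨θ.trace.re⁻¹ • θ, ⟨hθ.smul (inv_nonneg.2 hpos.le), ?_⟩, ?_⟩
  · rw [trace_smul, Complex.real_smul, htr, Complex.ofReal_re, ← Complex.ofReal_mul,
      inv_mul_cancel₀ hpos.ne', Complex.ofReal_one]
  · have h := hθ.smul (sub_nonneg.2 ((one_le_inv₀ hpos).2 hθ1))
    rwa [sub_smul, one_smul] at h

variable [DecidableEq A]

lemma mpow_zero_half : mpow (0 : Matrix A A ℂ) (1 / 2) = 0 := by
  have h := mpow_half_mul_conjTranspose (PosSemidef.zero (n := A) (R := ℂ))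
  rwa [self_mul_conjTranspose_eq_zero] at h

lemma ne_zero_of_pDist_lt_one {ρ ω : Matrix A A ℂ} (hρ : IsState ρ) (h : pDist ω ρ < 1) :
    ω ≠ 0 := by
  rintro rfl
  refine h.ne ?_
  simp [pDist, gFid, hρ.2, mpow_zero_half, traceNorm, -one_div]

lemma pDist_submatrix_le {B : Type*} [Fintype B] [DecidableEq B] (e : B ≃ A)
    {ρ σ : Matrix A A ℂ} (hρ : ρ.PosSemidef) (hσ : σ.PosSemidef) :
    pDist (ρ.submatrix e e) (σ.submatrix e e) ≤ pDist ρ σ := by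
  apply pDist_le_of_gFid_le
  rw [gFid, gFid, trace_submatrix_equiv, trace_submatrix_equiv]
  refine add_le_add_left ?_ _
  change rootFid ρ σ ≤ rootFid _ _
  obtain ⟨X, hX, h⟩ := exists_re_trace_eq_rootFid hρ σ
  rw [← h]
  refine le_trans (le_of_eq ?_) (re_trace_le_rootFid (hρ.submatrix e) (hσ.submatrix e)
    (X := X.submatrix e id) (Y := (mpow σ (1 / 2)).submatrix e id)
    (hX.submatrix e) ((sub_mpow_half_posSemidef hσ).submatrix e))
  rw [conjTranspose_submatrix, submatrix_mul_equiv, submatrix_id_id]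

end States

theorem hmin_chain_rule_smoothed
    {S L E : Type*} [Fintype S] [DecidableEq S] [Fintype L] [DecidableEq L]
    [Fintype E] [DecidableEq E]
    (ρ : Matrix (S × (L × E)) (S × (L × E)) ℂ) (hρ : IsState ρ)
    (ε : ℝ) (hε0 : 0 ≤ ε) (hε1 : ε < 1) :
    HminUpEps ε ρ ≥
      HminUpEps (ε / 3) (traceOut (eSEL S L E) ρ)
        - ImaxNDEps (ε / 3) ((Matrix.reindex (eLSE S L E) (eLSE S L E)) ρ) := by
  set π := Matrix.reindex (eLSE S L E) (eLSE S L E) ρ with hπ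
  have hπs : IsState π :=
    ⟨hρ.1.submatrix _, by rw [hπ, reindex_apply, trace_submatrix_equiv]; exact hρ.2⟩
  have hmarg : traceOut (eSEL S L E) ρ = ptA π := rfl
  have hmargs : IsState (ptA π) := ⟨ptA_posSemidef hπs.1, by rw [trace_ptA]; exact hπs.2⟩
  rw [hmarg, ge_iff_le, sub_eq_add_neg]
  refine EReal.add_le_of_forall_lt fun a ha b hb => ?_
  obtain ⟨_, ⟨ω, hω, hωπ, rfl⟩, ha⟩ := lt_sSup_iff.1 ha
  obtain ⟨_, ⟨σ, hσ, rfl⟩, ha⟩ := sInf_lt_iff.1 (EReal.lt_neg_comm.1 ha)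
  obtain ⟨_, ⟨lam, hlam, hωσ, rfl⟩, ha⟩ := sInf_lt_iff.1 ha
  obtain ⟨_, ⟨τ, hτ, hτπ, rfl⟩, hb⟩ := sInf_lt_iff.1 (EReal.lt_neg_comm.1 hb)
  obtain ⟨_, ⟨μ, hμ, hτμ, rfl⟩, hb⟩ := sInf_lt_iff.1 hb
  have hω0 := ne_zero_of_pDist_lt_one hmargs (hωπ.trans_lt (by linarith))
  have hτ0 := ne_zero_of_pDist_lt_one hπs (hτπ.trans_lt (by linarith))
  have hlam := pos_of_smul_sub_posSemidef hω.1 hω0 hlam hωσ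
  have hμ := pos_of_smul_sub_posSemidef hτ.1 hτ0 hμ hτμ
  obtain ⟨η, hη, hητ, hηle⟩ := exists_extension hτ hω
  have hτB := ptB_posSemidef hτ.1
  have hημ := hηle μ hμ.le _ hτB hτμ
  have hηπ : pDist η π ≤ ε := by
    have h1 := pDist_triangle hη hτ hπs.isSubState
    have h2 := pDist_triangle hω hmargs.isSubState hτ.ptA
    have h3 := pDist_ptA_le hτ.1 hπs.1
    rw [pDist_comm hmargs.1 hτ.ptA.1] at h2
    linarith
  obtain ⟨ξ, hξ, hξle⟩ := exists_state_ge hτB (by rw [trace_ptB]; exact hτ.2)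
    (fun h => hτ0 (hτ.1.trace_eq_zero_iff.1 (by rwa [trace_ptB] at h)))
  have hbound : ((lam * μ) • ((1 : Matrix S S ℂ) ⊗ₖ (ξ ⊗ₖ σ)) -
      η.submatrix (eLSE S L E) (eLSE S L E)).PosSemidef := by
    have h1 := (hτB.kronecker hωσ).smul hμ.le
    have h2 := (hξle.kronecker (PosSemidef.one (n := S) (R := ℂ)|>.kronecker hσ.1)).smul
      (mul_pos hlam hμ).le
    convert ((hημ.add h1).add h2).submatrix (eLSE S L E) using 1
    ext x y
    simp only [eLSE, Matrix.sub_apply, Matrix.add_apply, Matrix.smul_apply,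
      kroneckerMap_apply, submatrix_apply,
      Complex.real_smul, Equiv.coe_fn_mk]
    push_cast
    ring
  refine le_sSup_of_le ⟨η.submatrix (eLSE S L E) (eLSE S L E), ⟨hη.1.submatrix _, ?_⟩, ?_, rfl⟩ ?_
  · rw [trace_submatrix_equiv]
    exact hη.2
  · refine le_trans ?_ hηπ
    have hπρ : ρ = π.submatrix (eLSE S L E) (eLSE S L E) := by
      rw [hπ, reindex_apply, submatrix_submatrix]
      simp
    rw [hπρ]
    exact pDist_submatrix_le (eLSE S L E) hη.1 hπs.1
  · have h : HminUp (η.submatrix (eLSE S L E) (eLSE S L E)) ≥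
        -((Real.logb 2 (lam * μ) : ℝ) : EReal) := by
      refine EReal.neg_le_neg_iff.2 (sInf_le_of_le ⟨ξ ⊗ₖ σ, ⟨hξ.1.kronecker hσ.1, ?_⟩, rfl⟩
        (sInf_le ⟨lam * μ, (mul_pos hlam hμ).le, hbound, rfl⟩))
      rw [trace_kronecker, hξ.2, hσ.2, mul_one]
    refine le_trans ?_ h
    rw [Real.logb_mul hlam.ne' hμ.ne', ← EReal.coe_neg, neg_add, EReal.coe_add, EReal.coe_neg,
      EReal.coe_neg]
    exact add_le_add (EReal.lt_neg_comm.1 ha).le (EReal.lt_neg_comm.1 hb).le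

end QITLeak
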